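/- Let m ≥ 1 and let P ∈ ℚ[x₁,…,x_m] be a nonzero polynomial. Then the set W_P ⊆ ℂ^m, defined with K = ℂ, is a dense subset of ℂ^m. -/

import Mathlib

/-- The coefficient `ω(P) = P₀` of the highest power of the last variable `x_m` in
`P ∈ ℚ[x₁, …, x_m]`, a polynomial in the remaining variables (`ω(0) = 0`).  Here the
variables of `ℚ[x₁, …, x_{m+1}]` are indexed by `Fin (m + 1)`, the last variable being
`Fin.last m`; `P` is rewritten as a univariate polynomial in the last variable via the
rotation `finRotate` followed by `MvPolynomial.finSuccEquiv`, and `ω(P)` is its leading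
coefficient. -/
noncomputable def omegaPoly {m : ℕ} (P : MvPolynomial (Fin (m + 1)) ℚ) :
    MvPolynomial (Fin m) ℚ :=
  ((MvPolynomial.finSuccEquiv ℚ m) (MvPolynomial.rename (finRotate (m + 1)) P)).leadingCoeff

/-- The set `Γ_P = {λ ∈ K^m : P(λ₁, …, λ_{m−1}, λ_m + γ) = 0 for some real γ ≥ 0}`,
for `K = ℝ` or `K = ℂ` (an `RCLike` field). -/
def GammaSet (K : Type*) [RCLike K] {m : ℕ} (P : MvPolynomial (Fin (m + 1)) ℚ) :
    Set (Fin (m + 1) → K) :=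
  {x | ∃ γ : ℝ, 0 ≤ γ ∧
    MvPolynomial.aeval (Function.update x (Fin.last m) (x (Fin.last m) + algebraMap ℝ K γ)) P
      = 0}

/-- The sets `W_P ⊆ K^m` (`m ≥ 1`, indexing `K^m` by `Fin (m + 1)` with `m ≥ 0`), defined by
induction on the number of variables: `W_P = K ∖ Γ_P` in one variable, and
`W_P = (K^m ∖ Γ_P) ∩ (W_{ω(P)} × K)` in `m > 1` variables. -/
noncomputable def WSet (K : Type*) [RCLike K] :
    (m : ℕ) → MvPolynomial (Fin (m + 1)) ℚ → Set (Fin (m + 1) → K)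
  | 0, P => (GammaSet K P)ᶜ
  | m + 1, P =>
    (GammaSet K P)ᶜ ∩ {x | (fun i : Fin (m + 1) => x i.castSucc) ∈ WSet K m (omegaPoly P)}

open MvPolynomial in
theorem aeval_snoc_eq_eval_map {m : ℕ} (P : MvPolynomial (Fin (m + 1)) ℚ) (z : Fin m → ℂ)
    (t : ℂ) :
    aeval (Fin.snoc z t : Fin (m + 1) → ℂ) P =
      ((finSuccEquiv ℚ m (rename (finRotate (m + 1)) P)).map
        (aeval z : MvPolynomial (Fin m) ℚ →ₐ[ℚ] ℂ).toRingHom).eval t := by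
  induction P using MvPolynomial.induction_on with
  | C a => simp [finSuccEquiv_apply]
  | add p q hp hq => simp only [map_add, Polynomial.map_add, Polynomial.eval_add, hp, hq]
  | mul_X p i hp =>
    simp only [map_mul, Polynomial.map_mul, Polynomial.eval_mul, hp]
    congr 1
    refine Fin.lastCases ?_ (fun i => ?_) i
    · simp [finSuccEquiv_X_zero]
    · simp [finSuccEquiv_X_succ]

theorem omegaPoly_ne_zero {m : ℕ} {P : MvPolynomial (Fin (m + 1)) ℚ} (hP : P ≠ 0) :
    omegaPoly P ≠ 0 := by
  rw [omegaPoly, Ne, Polynomial.leadingCoeff_eq_zero, EmbeddingLike.map_eq_zero_iff,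
    map_eq_zero_iff _ (MvPolynomial.rename_injective _ (finRotate (m + 1)).injective)]
  exact hP

theorem dense_setOf_forall_eval_add_ofReal_ne_zero {f : Polynomial ℂ} (hf : f ≠ 0) :
    Dense {t : ℂ | ∀ γ : ℝ, f.eval (t + γ) ≠ 0} := by
  have hfin : (Complex.im '' {r | f.IsRoot r}).Finite :=
    (Polynomial.finite_setOfPred_isRoot hf).image _
  refine ((hfin.countable.dense_compl ℝ).preimage Complex.isOpenMap_im).mono ?_
  intro t ht γ h
  exact ht ⟨t + γ, h, by simp⟩

theorem dense_setOf_snoc_notMem_gammaSet {m : ℕ} (P : MvPolynomial (Fin (m + 1)) ℚ)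
    {z : Fin m → ℂ} (hz : MvPolynomial.aeval z (omegaPoly P) ≠ 0) :
    Dense {t : ℂ | (Fin.snoc z t : Fin (m + 1) → ℂ) ∉ GammaSet ℂ P} := by
  have hf : (MvPolynomial.finSuccEquiv ℚ m (MvPolynomial.rename (finRotate (m + 1)) P)).map
      (MvPolynomial.aeval z : MvPolynomial (Fin m) ℚ →ₐ[ℚ] ℂ).toRingHom ≠ 0 := fun h => hz <| by
    have := congrArg (fun q => q.coeff (MvPolynomial.finSuccEquiv ℚ m
      (MvPolynomial.rename (finRotate (m + 1)) P)).natDegree) h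
    simpa [omegaPoly] using this
  refine (dense_setOf_forall_eval_add_ofReal_ne_zero hf).mono ?_
  rintro t ht ⟨γ, -, h⟩
  rw [Fin.snoc_last, Fin.update_snoc_last, aeval_snoc_eq_eval_map] at h
  exact ht γ h

theorem aeval_ne_zero_of_mem_WSet {K : Type*} [RCLike K] {m : ℕ}
    {P : MvPolynomial (Fin (m + 1)) ℚ} {x : Fin (m + 1) → K} (hx : x ∈ WSet K m P) :
    MvPolynomial.aeval x P ≠ 0 := by
  have hx' : x ∉ GammaSet K P := by
    cases m with
    | zero => exact hx
    | succ m => exact hx.1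
  exact fun h => hx' ⟨0, le_rfl, by simpa using h⟩

theorem dense_of_dense_snoc {X : Type*} [TopologicalSpace X] {m : ℕ} {A : Set (Fin m → X)}
    {S : Set (Fin (m + 1) → X)} (hA : Dense A)
    (hS : ∀ z ∈ A, Dense {t : X | (Fin.snoc z t : Fin (m + 1) → X) ∈ S}) : Dense S := by
  refine dense_iff_inter_open.2 fun U hU ⟨x, hx⟩ => ?_
  obtain ⟨z, hzU, hzA⟩ := dense_iff_inter_open.1 hA
    {z | (Fin.snoc z (x (Fin.last m)) : Fin (m + 1) → X) ∈ U}
    (hU.preimage (continuous_id.finSnoc continuous_const))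
    ⟨Fin.init x, by simpa using hx⟩
  obtain ⟨t, htU, htS⟩ := dense_iff_inter_open.1 (hS z hzA)
    {t | (Fin.snoc z t : Fin (m + 1) → X) ∈ U}
    (hU.preimage (continuous_const.finSnoc continuous_id)) ⟨_, hzU⟩
  exact ⟨_, htU, htS⟩

/-- Property R4 of the sets `W_P` in the complex case: for nonzero `P`, the set
`W_P ⊆ ℂ^m` is dense. -/
theorem statement18 (m : ℕ) (P : MvPolynomial (Fin (m + 1)) ℚ) (hP : P ≠ 0) :
    Dense (WSet ℂ m P) := by
  induction m with
  | zero =>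
    refine dense_of_dense_snoc dense_univ fun z _ => dense_setOf_snoc_notMem_gammaSet P ?_
    have h := omegaPoly_ne_zero hP
    rw [MvPolynomial.eq_C_of_isEmpty (omegaPoly P)] at h ⊢
    simpa using h
  | succ m ih =>
    refine dense_of_dense_snoc (ih _ (omegaPoly_ne_zero hP)) fun z hz =>
      (dense_setOf_snoc_notMem_gammaSet P (aeval_ne_zero_of_mem_WSet hz)).mono fun t ht => ?_
    refine ⟨ht, ?_⟩
    simpa using hz
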